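/- Let G and H be finitely generated groups of polynomial growth with finite symmetric generating sets, word lengths |·|_G, |·|_H and balls B_G(r), B_H(r), and suppose G and H are integrably measure equivalent (they admit a measure coupling (Ω,m) with commuting m-preserving essentially free actions, finite-measure fundamental domains Y for G and X for H, and integrable associated cocycles α : G × X → H, β : H × Y → G). Then for every M > 0 there exists a constant D ≥ 1 such that D⁻¹·|B_G(D⁻¹·M·r)| ≤ |B_H(r)| ≤ D·|B_G(D·M·r)| for all r > 0. -/

import Mathlib

open MeasureTheory

/-- Word length of `g` with respect to a generating set `S`:
the least `n` such that `g` is a product of `n` elements of `S`. -/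
noncomputable def wlen {G : Type*} [Group G] (S : Set G) (g : G) : ℕ :=
  sInf {n : ℕ | ∃ l : List G, (∀ s ∈ l, s ∈ S) ∧ l.length = n ∧ l.prod = g}

section WordLength

variable {G : Type*} [Group G] {S : Set G}

theorem exists_list_wlen (hSsymm : ∀ s ∈ S, s⁻¹ ∈ S) (hSgen : Subgroup.closure S = ⊤) (g : G) :
    ∃ l : List G, (∀ s ∈ l, s ∈ S) ∧ l.length = wlen S g ∧ l.prod = g := by
  have hne : {n : ℕ | ∃ l : List G, (∀ s ∈ l, s ∈ S) ∧ l.length = n ∧ l.prod = g}.Nonempty := by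
    have hg : g ∈ (Subgroup.closure S).toSubmonoid := by rw [hSgen]; trivial
    rw [Subgroup.closure_toSubmonoid] at hg
    obtain ⟨l, hl, hprod⟩ := Submonoid.exists_list_of_mem_closure hg
    refine ⟨l.length, l, fun s hs => ?_, rfl, hprod⟩
    rcases hl s hs with h | h
    · exact h
    · simpa using hSsymm _ h
  exact Nat.sInf_mem hne

theorem wlen_list_prod_le {l : List G} (hl : ∀ s ∈ l, s ∈ S) : wlen S l.prod ≤ l.length :=
  Nat.sInf_le ⟨l, hl, rfl, rfl⟩

theorem wlen_one : wlen S (1 : G) = 0 :=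
  Nat.le_zero.1 (wlen_list_prod_le (l := []) (by simp))

theorem wlen_mul_le (hSsymm : ∀ s ∈ S, s⁻¹ ∈ S) (hSgen : Subgroup.closure S = ⊤) (g g' : G) :
    wlen S (g * g') ≤ wlen S g + wlen S g' := by
  obtain ⟨l, hl, hlen, hprod⟩ := exists_list_wlen hSsymm hSgen g
  obtain ⟨l', hl', hlen', hprod'⟩ := exists_list_wlen hSsymm hSgen g'
  rw [← hlen, ← hlen', ← List.length_append, ← hprod, ← hprod', ← List.prod_append]
  refine wlen_list_prod_le fun s hs => ?_
  rcases List.mem_append.1 hs with h | h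
  exacts [hl s h, hl' s h]

theorem finite_setOf_wlen_le (hSfin : S.Finite) (hSsymm : ∀ s ∈ S, s⁻¹ ∈ S)
    (hSgen : Subgroup.closure S = ⊤) (r : ℝ) : {g : G | (wlen S g : ℝ) ≤ r}.Finite := by
  have := hSfin.to_subtype
  refine ((List.finite_length_le S ⌊r⌋₊).image fun l => (l.map Subtype.val).prod).subset ?_
  intro g hg
  obtain ⟨l, hl, hlen, hprod⟩ := exists_list_wlen hSsymm hSgen g
  refine ⟨l.attach.map fun s => ⟨s.1, hl s.1 s.2⟩, ?_, ?_⟩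
  · simpa [hlen] using Nat.le_floor hg
  · simpa [Function.comp_def] using hprod

end WordLength

section Coupling

open scoped ENNReal Pointwise

variable {G H Ω : Type*} [Group G] [Group H] [MulAction G Ω] [MulAction H Ω]
  {S : Set G} {X Y : Set Ω}

/-- The word length of the element bringing `ω` into the fundamental domain `Y`, written as
a sum over all elements that do so in order to be measurable and defined everywhere. -/
noncomputable def lengthTo (S : Set G) (Y : Set Ω) (ω : Ω) : ℝ≥0∞ :=
  ∑' g : G, Y.indicator (fun _ => (wlen S g : ℝ≥0∞)) (g • ω)

theorem wlen_le_lengthTo {g : G} {ω : Ω} (hg : g • ω ∈ Y) : (wlen S g : ℝ≥0∞) ≤ lengthTo S Y ω := by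
  refine le_trans ?_ (ENNReal.le_tsum g)
  rw [Set.indicator_of_mem hg]

theorem lengthTo_eq {g : G} {ω : Ω} (hω : ∃! g : G, g • ω ∈ Y) (hg : g • ω ∈ Y) :
    lengthTo S Y ω = wlen S g := by
  rw [lengthTo, tsum_eq_single g, Set.indicator_of_mem hg]
  intro g' hg'
  exact Set.indicator_of_notMem (fun h => hg' (hω.unique h hg)) _

variable [MeasurableSpace Ω] {m : Measure Ω}

theorem measurable_lengthTo [Countable G] [MeasurableConstSMul G Ω] (hY : MeasurableSet Y) :
    Measurable (lengthTo S Y) :=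
  Measurable.tsum fun g => (measurable_const.indicator hY).comp (measurable_const_smul g)

theorem isFundamentalDomain_of_existsUnique [MeasurableConstSMul G Ω] [SMulInvariantMeasure G Ω m]
    (hY : MeasurableSet Y) (hfund : ∀ᵐ ω ∂m, ∃! g : G, g • ω ∈ Y) :
    IsFundamentalDomain G Y m where
  nullMeasurableSet := hY.nullMeasurableSet
  ae_covers := hfund.mono fun _ h => h.exists
  aedisjoint g g' hne := by
    refine measure_mono_null ?_ (ae_iff.1 hfund)
    rintro ω ⟨hg, hg'⟩ hω
    rw [Set.mem_smul_set_iff_inv_smul_mem] at hg hg'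
    exact hne (inv_injective (hω.unique hg hg'))

variable [MeasurableConstSMul H Ω] [SMulInvariantMeasure H Ω m]

theorem lintegral_lengthTo_lt_top_of_cocycle (hY : MeasurableSet Y)
    (hYfund : ∀ᵐ ω ∂m, ∃! g : G, g • ω ∈ Y) {β : H → Ω → G}
    (hβdef : ∀ h : H, ∀ᵐ ω ∂m, ω ∈ Y → β h ω • h • ω ∈ Y)
    (hβint : ∀ h : H, IntegrableOn (fun ω => (wlen S (β h ω) : ℝ)) Y m) (h : H) :
    ∫⁻ y in Y, lengthTo S Y (h • y) ∂m < ⊤ := by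
  have hfin := (hasFiniteIntegral_iff_ofReal (ae_of_all _ fun _ => Nat.cast_nonneg _)).1
    (hβint h).hasFiniteIntegral
  refine lt_of_le_of_lt (lintegral_mono_ae ?_) hfin
  filter_upwards [ae_restrict_of_ae (hβdef h), ae_restrict_mem hY, ae_restrict_of_ae
    ((measurePreserving_smul h m).quasiMeasurePreserving.ae hYfund)] with y hy hyY hu
  rw [lengthTo_eq hu (hy hyY), ENNReal.ofReal_natCast]

theorem sum_measure_inter_preimage_le [Countable H] [SMulInvariantMeasure G Ω m]
    (hX : IsFundamentalDomain H X m) (g : G) (t : Finset H) :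
    ∑ h ∈ t, m (X ∩ {ω | g • h • ω ∈ Y}) ≤ m Y := by
  calc ∑ h ∈ t, m (X ∩ {ω | g • h • ω ∈ Y})
      ≤ ∑' h : H, m (X ∩ {ω | g • h • ω ∈ Y}) := ENNReal.sum_le_tsum t
    _ = ∑' h : H, m (h • (g⁻¹ • Y) ∩ X) := by
        rw [← (Equiv.inv H).tsum_eq fun h : H => m (h • (g⁻¹ • Y) ∩ X)]
        refine tsum_congr fun h => ?_
        congr 1
        ext ω
        simp [Set.mem_smul_set_iff_inv_smul_mem, and_comm]
    _ = m Y := by rw [← hX.measure_eq_tsum, measure_smul]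

variable [Countable G] [MeasurableConstSMul G Ω] [SMulInvariantMeasure G Ω m]
  [SMulCommClass H G Ω]

theorem lintegral_lengthTo_mul_le (hSsymm : ∀ s ∈ S, s⁻¹ ∈ S) (hSgen : Subgroup.closure S = ⊤)
    (hY : MeasurableSet Y) (hYfund : ∀ᵐ ω ∂m, ∃! g : G, g • ω ∈ Y) (s h : H) :
    ∫⁻ y in Y, lengthTo S Y ((s * h) • y) ∂m ≤
      (∫⁻ y in Y, lengthTo S Y (s • y) ∂m) + ∫⁻ y in Y, lengthTo S Y (h • y) ∂m := by
  have hdom : IsFundamentalDomain G Y m := isFundamentalDomain_of_existsUnique hY hYfund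
  have hmeas : Measurable (lengthTo S Y) := measurable_lengthTo hY
  -- the `G`-invariant function that agrees with `lengthTo S Y (s • ·)` on `Y`
  let F : Ω → ℝ≥0∞ := fun ω => ∑' g : G, Y.indicator (fun y => lengthTo S Y (s • y)) (g • ω)
  have hFinv : ∀ (g : G) (ω : Ω), F (g • ω) = F ω := fun g ω => by
    simp only [F, smul_smul]
    exact (Equiv.mulRight g).tsum_eq
      fun g' => Y.indicator (fun y => lengthTo S Y (s • y)) (g' • ω)
  have hsub : ∀ᵐ ω ∂m, lengthTo S Y (s • ω) ≤ F ω + lengthTo S Y ω := by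
    filter_upwards [hYfund, (measurePreserving_smul s m).quasiMeasurePreserving.ae hYfund]
      with ω hω hsω
    obtain ⟨g, hg⟩ := hω.exists
    obtain ⟨g', hg'⟩ := hsω.exists
    have hF : (wlen S (g' * g⁻¹) : ℝ≥0∞) ≤ F ω := by
      refine le_trans ?_ (ENNReal.le_tsum g)
      rw [Set.indicator_of_mem hg]
      apply wlen_le_lengthTo
      rwa [smul_comm s g ω, smul_smul, inv_mul_cancel_right]
    rw [lengthTo_eq hsω hg']
    calc (wlen S g' : ℝ≥0∞) = (wlen S (g' * g⁻¹ * g) : ℝ≥0∞) := by rw [inv_mul_cancel_right]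
      _ ≤ wlen S (g' * g⁻¹) + wlen S g := by exact_mod_cast wlen_mul_le hSsymm hSgen _ _
      _ ≤ F ω + lengthTo S Y ω := add_le_add hF (wlen_le_lengthTo hg)
  have hFY : ∫⁻ y in Y, F y ∂m = ∫⁻ y in Y, lengthTo S Y (s • y) ∂m := by
    refine setLIntegral_congr_fun_ae hY ?_
    filter_upwards [hYfund] with y hy hyY
    have hone : (1 : G) • y ∈ Y := by rwa [one_smul]
    simp only [F]
    rw [tsum_eq_single (1 : G), Set.indicator_of_mem hone, one_smul]
    intro g hg
    exact Set.indicator_of_notMem (fun h => hg (hy.unique h hone)) _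
  have hFh : ∫⁻ y in Y, F (h • y) ∂m = ∫⁻ y in Y, F y ∂m := by
    have hpre := (measurePreserving_smul h m).setLIntegral_comp_preimage_emb
      (measurableEmbedding_const_smul h) F (h • Y)
    rw [Set.preimage_smul, inv_smul_smul] at hpre
    rw [hpre]
    exact (hdom.smul_of_comm h).setLIntegral_eq hdom F hFinv
  calc ∫⁻ y in Y, lengthTo S Y ((s * h) • y) ∂m
      ≤ ∫⁻ y in Y, (F (h • y) + lengthTo S Y (h • y)) ∂m := by
        refine lintegral_mono_ae (ae_restrict_of_ae ?_)
        filter_upwards [(measurePreserving_smul h m).quasiMeasurePreserving.ae hsub] with y hy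
        rwa [mul_smul]
    _ = _ := by
        rw [← hFY, ← hFh]
        exact lintegral_add_right _ (hmeas.comp (measurable_const_smul h))

theorem lintegral_lengthTo_le {SH : Set H} (hSsymm : ∀ s ∈ S, s⁻¹ ∈ S)
    (hSgen : Subgroup.closure S = ⊤) (hSHsymm : ∀ s ∈ SH, s⁻¹ ∈ SH)
    (hSHgen : Subgroup.closure SH = ⊤)
    (hY : MeasurableSet Y) (hYfund : ∀ᵐ ω ∂m, ∃! g : G, g • ω ∈ Y) {K : ℝ≥0∞}
    (hK : ∀ s ∈ SH, ∫⁻ y in Y, lengthTo S Y (s • y) ∂m ≤ K) (h : H) :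
    ∫⁻ y in Y, lengthTo S Y (h • y) ∂m ≤ wlen SH h * K := by
  obtain ⟨l, hl, hlen, rfl⟩ := exists_list_wlen hSHsymm hSHgen h
  rw [← hlen]
  clear hlen
  induction l with
  | nil =>
    have hzero : ∀ᵐ y ∂m.restrict Y, lengthTo S Y ((1 : H) • y) = 0 := by
      filter_upwards [ae_restrict_of_ae hYfund, ae_restrict_mem hY] with y hy hyY
      have hone : (1 : G) • y ∈ Y := by rwa [one_smul]
      rw [one_smul, lengthTo_eq hy hone, wlen_one, Nat.cast_zero]
    rw [List.prod_nil, lintegral_congr_ae hzero]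
    simp
  | cons s l ih =>
    rw [List.prod_cons, List.length_cons, Nat.cast_succ, add_mul, one_mul, add_comm]
    exact (lintegral_lengthTo_mul_le hSsymm hSgen hY hYfund s l.prod).trans
      (add_le_add (hK s (hl s (by simp))) (ih fun t ht => hl t (by simp [ht])))

/-- One half of Bowen's theorem: the growth of `H` is dominated by that of `G` as soon as the
cocycle `H × Y → G` is integrable. -/
theorem ncard_ball_le_of_coupling [Countable H] {SH : Set H} (hSfin : S.Finite) (hSsymm : ∀ s ∈ S, s⁻¹ ∈ S)
    (hSgen : Subgroup.closure S = ⊤) (hSHfin : SH.Finite) (hSHsymm : ∀ s ∈ SH, s⁻¹ ∈ SH)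
    (hSHgen : Subgroup.closure SH = ⊤) (hm : m ≠ 0)
    (hX : MeasurableSet X) (hY : MeasurableSet Y) (hYfin : m Y < ⊤)
    (hXfund : ∀ᵐ ω ∂m, ∃! h : H, h • ω ∈ X) (hYfund : ∀ᵐ ω ∂m, ∃! g : G, g • ω ∈ Y)
    (hint : ∀ h : H, ∫⁻ y in Y, lengthTo S Y (h • y) ∂m < ⊤) :
    ∃ C L : ℝ, 0 < C ∧ 0 < L ∧ ∀ r : ℝ, 0 < r →
      ({h : H | (wlen SH h : ℝ) ≤ r}.ncard : ℝ) ≤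
        C * ({g : G | (wlen S g : ℝ) ≤ L * r}.ncard : ℝ) := by
  have hXdom : IsFundamentalDomain H X m := isFundamentalDomain_of_existsUnique hX hXfund
  have hYdom : IsFundamentalDomain G Y m := isFundamentalDomain_of_existsUnique hY hYfund
  have hYne : m Y ≠ 0 := hYdom.measure_ne_zero hm
  obtain ⟨h₀, hh₀⟩ : ∃ h₀ : H, m (Y ∩ h₀ • X) ≠ 0 := by
    by_contra! hzero
    exact hYne (by rw [hXdom.measure_eq_tsum' Y]; simp [hzero])
  have hZfin : m (Y ∩ h₀ • X) ≠ ⊤ := measure_ne_top_of_subset Set.inter_subset_left hYfin.ne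
  set Z := Y ∩ h₀ • X with hZ
  obtain ⟨k, hk, hkle⟩ : ∃ k : ℝ, 0 < k ∧
      ∀ s ∈ SH, ∫⁻ y in Y, lengthTo S Y (s • y) ∂m ≤ ENNReal.ofReal k := by
    have hfin : ∑ s ∈ hSHfin.toFinset, ∫⁻ y in Y, lengthTo S Y (s • y) ∂m ≠ ⊤ :=
      (ENNReal.sum_lt_top.2 fun s _ => hint s).ne
    refine ⟨(∑ s ∈ hSHfin.toFinset, ∫⁻ y in Y, lengthTo S Y (s • y) ∂m).toReal + 1,
      by positivity, fun s hs => ?_⟩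
    refine (Finset.single_le_sum (f := fun s : H => ∫⁻ y in Y, lengthTo S Y (s • y) ∂m)
      (fun _ _ => zero_le) (hSHfin.mem_toFinset.2 hs)).trans ?_
    exact (ENNReal.le_ofReal_iff_toReal_le hfin (by positivity)).2 (by linarith)
  set z := (m Z).toReal with hz
  have hz0 : 0 < z := ENNReal.toReal_pos hh₀ hZfin
  have hmZ : m Z = ENNReal.ofReal z := (ENNReal.ofReal_toReal hZfin).symm
  have hY0 : 0 < (m Y).toReal := ENNReal.toReal_pos hYne hYfin.ne
  refine ⟨2 * (m Y).toReal / z, 2 * k / z, by positivity, by positivity, fun r hr => ?_⟩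
  set L := 2 * k / z with hL
  have hLr : 0 < L * r := by positivity
  have hBH := finite_setOf_wlen_le hSHfin hSHsymm hSHgen r
  have hBG := finite_setOf_wlen_le hSfin hSsymm hSgen (L * r)
  have hbig : ∀ h : H, (wlen SH h : ℝ) ≤ r →
      m (Y ∩ {y | ENNReal.ofReal (L * r) ≤ lengthTo S Y (h • y)}) ≤ ENNReal.ofReal (z / 2) := by
    intro h hh
    have hmeas : Measurable fun y => lengthTo S Y (h • y) :=
      (measurable_lengthTo hY).comp (measurable_const_smul h)
    have hcheb := (mul_meas_ge_le_lintegral₀ (μ := m.restrict Y) hmeas.aemeasurable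
      (ENNReal.ofReal (L * r))).trans
      (lintegral_lengthTo_le hSsymm hSgen hSHsymm hSHgen hY hYfund hkle h)
    rw [Measure.restrict_apply (measurableSet_le measurable_const hmeas), Set.inter_comm] at hcheb
    have hkr : (wlen SH h : ℝ≥0∞) * ENNReal.ofReal k ≤ ENNReal.ofReal (r * k) := by
      rw [ENNReal.ofReal_mul hr.le, ← ENNReal.ofReal_natCast]
      gcongr
    have hdiv : z / 2 = r * k / (L * r) := by rw [hL]; field_simp
    rw [hdiv, ENNReal.ofReal_div_of_pos hLr, ENNReal.le_div_iff_mul_le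
      (Or.inl (ENNReal.ofReal_pos.2 hLr).ne') (Or.inl ENNReal.ofReal_ne_top), mul_comm]
    exact hcheb.trans hkr
  have hsmall : ∀ h : H, (wlen SH h : ℝ) ≤ r →
      ENNReal.ofReal (z / 2) ≤ ∑ g ∈ hBG.toFinset, m (h₀ • X ∩ {ω | g • h • ω ∈ Y}) := by
    intro h hh
    have hcover : Z ≤ᵐ[m] ((Y ∩ {y | ENNReal.ofReal (L * r) ≤ lengthTo S Y (h • y)}) ∪
        ⋃ g ∈ hBG.toFinset, h₀ • X ∩ {ω | g • h • ω ∈ Y} : Set Ω) := by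
      filter_upwards [(measurePreserving_smul h m).quasiMeasurePreserving.ae hYfund]
        with y hy hyZ
      by_cases hlarge : ENNReal.ofReal (L * r) ≤ lengthTo S Y (h • y)
      · exact Or.inl ⟨hyZ.1, hlarge⟩
      · obtain ⟨g, hg⟩ := hy.exists
        rw [lengthTo_eq hy hg, ← ENNReal.ofReal_natCast,
          ENNReal.ofReal_le_ofReal_iff (Nat.cast_nonneg _), not_le] at hlarge
        exact Or.inr (Set.mem_iUnion₂.2 ⟨g, hBG.mem_toFinset.2 hlarge.le, hyZ.2, hg⟩)
    have hle := (measure_mono_ae hcover).trans (measure_union_le _ _)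
    have hsplit : m Z = ENNReal.ofReal (z / 2) + ENNReal.ofReal (z / 2) := by
      rw [hmZ, ← ENNReal.ofReal_add (by positivity) (by positivity), add_halves]
    rw [hsplit] at hle
    refine (ENNReal.add_le_add_iff_left ENNReal.ofReal_ne_top).1
      (hle.trans (add_le_add (hbig h hh) (measure_biUnion_finset_le _ _)))
  have hcount : (hBH.toFinset.card : ℝ≥0∞) * ENNReal.ofReal (z / 2) ≤
      hBG.toFinset.card * m Y := by
    rw [← nsmul_eq_mul, ← nsmul_eq_mul, ← Finset.sum_const, ← Finset.sum_const]
    refine (Finset.sum_le_sum fun h hh => hsmall h (hBH.mem_toFinset.1 hh)).trans ?_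
    rw [Finset.sum_comm]
    exact Finset.sum_le_sum fun g _ => sum_measure_inter_preimage_le (hXdom.smul h₀) g _
  have hreal := ENNReal.toReal_mono
    (ENNReal.mul_ne_top (ENNReal.natCast_ne_top _) hYfin.ne) hcount
  rw [ENNReal.toReal_mul, ENNReal.toReal_mul, ENNReal.toReal_natCast, ENNReal.toReal_natCast,
    ENNReal.toReal_ofReal (by positivity)] at hreal
  rw [Set.ncard_eq_toFinset_card _ hBH, Set.ncard_eq_toFinset_card _ hBG, div_mul_eq_mul_div,
    le_div_iff₀ hz0]
  linarith

end Coupling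

theorem stmt18 {G H : Type*} [Group G] [Group H] [Countable G] [Countable H]
    (SG : Set G) (hSGfin : SG.Finite) (hSGsymm : ∀ s ∈ SG, s⁻¹ ∈ SG)
    (hSGgen : Subgroup.closure SG = ⊤)
    (SH : Set H) (hSHfin : SH.Finite) (hSHsymm : ∀ s ∈ SH, s⁻¹ ∈ SH)
    (hSHgen : Subgroup.closure SH = ⊤)
    -- `G` and `H` have polynomial growth
    (hGpoly : ∃ C : ℝ, ∃ dG : ℕ, 0 < C ∧ 0 < dG ∧ ∀ n : ℕ, 1 ≤ n →
      (({g : G | wlen SG g ≤ n}).ncard : ℝ) ≤ C * (n : ℝ) ^ dG)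
    (hHpoly : ∃ C : ℝ, ∃ dH : ℕ, 0 < C ∧ 0 < dH ∧ ∀ n : ℕ, 1 ≤ n →
      (({h : H | wlen SH h ≤ n}).ncard : ℝ) ≤ C * (n : ℝ) ^ dH)
    -- the coupling space
    {Ω : Type*} [MeasurableSpace Ω] (m : Measure Ω) [SigmaFinite m] (hm : m ≠ 0)
    -- commuting measure-preserving actions of `G` and `H`
    (A : G → Ω → Ω) (B : H → Ω → Ω)
    (hA1 : ∀ ω, A 1 ω = ω) (hAmul : ∀ g g' ω, A (g * g') ω = A g (A g' ω))
    (hB1 : ∀ ω, B 1 ω = ω) (hBmul : ∀ h h' ω, B (h * h') ω = B h (B h' ω))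
    (hAmeas : ∀ g, Measurable (A g)) (hBmeas : ∀ h, Measurable (B h))
    (hApres : ∀ g, MeasurePreserving (A g) m m)
    (hBpres : ∀ h, MeasurePreserving (B h) m m)
    (hcomm : ∀ g h ω, A g (B h ω) = B h (A g ω))
    -- essential freeness
    (hAfree : ∀ᵐ ω ∂m, ∀ g : G, A g ω = ω → g = 1)
    (hBfree : ∀ᵐ ω ∂m, ∀ h : H, B h ω = ω → h = 1)
    -- finite-measure fundamental domains: `Y` for the `G`-action, `X` for the `H`-action
    (X Y : Set Ω) (hXmeas : MeasurableSet X) (hYmeas : MeasurableSet Y)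
    (hXfin : m X < ⊤) (hYfin : m Y < ⊤)
    (hXfund : ∀ᵐ ω ∂m, ∃! h : H, B h ω ∈ X)
    (hYfund : ∀ᵐ ω ∂m, ∃! g : G, A g ω ∈ Y)
    -- the associated cocycles, determined by `g·x ∈ α(g,x)⁻¹·X` and `h·y ∈ β(h,y)⁻¹·Y`
    (α : G → Ω → H) (hαmeas : ∀ (g : G) (h : H), MeasurableSet {ω | α g ω = h})
    (hαdef : ∀ g : G, ∀ᵐ ω ∂m, ω ∈ X → B (α g ω) (A g ω) ∈ X)
    (β : H → Ω → G) (hβmeas : ∀ (h : H) (g : G), MeasurableSet {ω | β h ω = g})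
    (hβdef : ∀ h : H, ∀ᵐ ω ∂m, ω ∈ Y → A (β h ω) (B h ω) ∈ Y)
    -- integrability of the coupling
    (hαint : ∀ g : G, IntegrableOn (fun ω => (wlen SH (α g ω) : ℝ)) X m)
    (hβint : ∀ h : H, IntegrableOn (fun ω => (wlen SG (β h ω) : ℝ)) Y m) :
    ∀ M : ℝ, 0 < M → ∃ D : ℝ, 1 ≤ D ∧ ∀ r : ℝ, 0 < r →
      D⁻¹ * (({g : G | (wlen SG g : ℝ) ≤ D⁻¹ * M * r}).ncard : ℝ) ≤
          (({h : H | (wlen SH h : ℝ) ≤ r}).ncard : ℝ) ∧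
      (({h : H | (wlen SH h : ℝ) ≤ r}).ncard : ℝ) ≤
          D * (({g : G | (wlen SG g : ℝ) ≤ D * M * r}).ncard : ℝ) := by
  let _ : MulAction G Ω := { smul := A, one_smul := hA1, mul_smul := hAmul }
  let _ : MulAction H Ω := { smul := B, one_smul := hB1, mul_smul := hBmul }
  have : MeasurableConstSMul G Ω := ⟨hAmeas⟩
  have : MeasurableConstSMul H Ω := ⟨hBmeas⟩
  have : SMulInvariantMeasure G Ω m :=
    ⟨fun g _ hs => (hApres g).measure_preimage hs.nullMeasurableSet⟩
  have : SMulInvariantMeasure H Ω m :=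
    ⟨fun h _ hs => (hBpres h).measure_preimage hs.nullMeasurableSet⟩
  have : SMulCommClass G H Ω := ⟨hcomm⟩
  have : SMulCommClass H G Ω := SMulCommClass.symm G H Ω
  obtain ⟨C, L, hC, hL, hHG⟩ := ncard_ball_le_of_coupling hSGfin hSGsymm hSGgen
    hSHfin hSHsymm hSHgen hm hXmeas hYmeas hYfin hXfund hYfund
    (lintegral_lengthTo_lt_top_of_cocycle hYmeas hYfund hβdef hβint)
  obtain ⟨C', L', hC', hL', hGH⟩ := ncard_ball_le_of_coupling hSHfin hSHsymm hSHgen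
    hSGfin hSGsymm hSGgen hm hYmeas hXmeas hXfin hYfund hXfund
    (lintegral_lengthTo_lt_top_of_cocycle hXmeas hXfund hαdef hαint)
  intro M hM
  obtain ⟨D, hD⟩ := Finset.exists_le ({1, C, C', L / M, L' * M} : Finset ℝ)
  have hD1 : 1 ≤ D := hD _ (by simp)
  have hCD : C ≤ D := hD _ (by simp)
  have hCD' : C' ≤ D := hD _ (by simp)
  have hLD : L / M ≤ D := hD _ (by simp)
  have hLD' : L' * M ≤ D := hD _ (by simp)
  have hD0 : 0 < D := by linarith
  refine ⟨D, hD1, fun r hr => ⟨?_, ?_⟩⟩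
  · have hsub : {h : H | (wlen SH h : ℝ) ≤ L' * (D⁻¹ * M * r)} ⊆ {h : H | (wlen SH h : ℝ) ≤ r} := by
      intro h hh
      refine le_trans (Set.mem_ofPred.1 hh) ?_
      calc L' * (D⁻¹ * M * r) = D⁻¹ * (L' * M) * r := by ring
        _ ≤ D⁻¹ * D * r := by gcongr
        _ = r := by rw [inv_mul_cancel₀ hD0.ne', one_mul]
    have hcard := Set.ncard_le_ncard hsub (finite_setOf_wlen_le hSHfin hSHsymm hSHgen r)
    rw [inv_mul_le_iff₀ hD0]
    refine (hGH (D⁻¹ * M * r) (by positivity)).trans ?_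
    gcongr
  · have hsub : {g : G | (wlen SG g : ℝ) ≤ L * r} ⊆ {g : G | (wlen SG g : ℝ) ≤ D * M * r} := by
      intro g hg
      refine le_trans (Set.mem_ofPred.1 hg) ?_
      gcongr
      exact (div_le_iff₀ hM).1 hLD
    have hcard := Set.ncard_le_ncard hsub (finite_setOf_wlen_le hSGfin hSGsymm hSGgen (D * M * r))
    refine (hHG r hr).trans ?_
    gcongr
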